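/- Let $F$ be a complete discretely valued field of characteristic zero with valuation ring $O_F$ and finite residue field $\mathbb{F}_q$. Let $\Gamma$ be a compact subgroup of $\mathrm{GL}(V)$ for a finite-dimensional $F$-vector space $V$, acting semisimply on $V$. Suppose for some $\Gamma$-stable $O_F$-lattice $\Lambda \subset V$, the reduction $\Lambda \otimes_{O_F} \mathbb{F}_q$ is a semisimple $\Gamma$-representation and $\dim_F \mathrm{End}_\Gamma(V) = \dim_{\mathbb{F}_q} \mathrm{End}_\Gamma(\Lambda \otimes_{O_F} \mathbb{F}_q)$. Then for every $\Gamma$-subrepresentation $W \subseteq V$ and every $\Gamma$-stable lattice $\Lambda_W \subset W$, the reduction $\Lambda_W \otimes_{O_F} \mathbb{F}_q$ is semisimple and $\dim_F \mathrm{End}_\Gamma(W) = \dim_{\mathbb{F}_q} \mathrm{End}_\Gamma(\Lambda_W \otimes_{O_F} \mathbb{F}_q)$. -/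

import Mathlib

open Valued IsLocalRing

noncomputable section

/-- `ℤₘ₀ = WithZero (Multiplicative ℤ)`, the value group of a discrete valuation. -/
abbrev Zm0 := WithZero (Multiplicative ℤ)

variable {F : Type} [Field F] [Valued F Zm0] {m : ℕ}

/-- The valuation ring `O_F` of a (discretely) valued field `F`. -/
def OF (F : Type) [Field F] [Valued F Zm0] : ValuationSubring F :=
  (Valued.v).valuationSubring

/-- The matrix `g` stabilizes the `O_F`-submodule `Λ` of `F^m`. -/
def MStab (Λ : Submodule ↥(OF F) (Fin m → F)) (g : Matrix (Fin m) (Fin m) F) : Prop :=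
  ∀ x ∈ Λ, g.mulVecLin x ∈ Λ

/-- The `O_F`-linear endomorphism of `Λ` induced by a stabilizing matrix. -/
def latMap (Λ : Submodule ↥(OF F) (Fin m → F)) (g : Matrix (Fin m) (Fin m) F)
    (h : MStab Λ g) : ↥Λ →ₗ[↥(OF F)] ↥Λ :=
  LinearMap.restrict ((g.mulVecLin).restrictScalars ↥(OF F)) h

/-- The reduction `Λ ⊗_{O_F} 𝔽_q = Λ / 𝔪·Λ` of a lattice modulo the maximal ideal. -/
def Red (Λ : Submodule ↥(OF F) (Fin m → F)) : Type :=
  ↥Λ ⧸ ((maximalIdeal ↥(OF F)) • (⊤ : Submodule ↥(OF F) ↥Λ))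

instance (Λ : Submodule ↥(OF F) (Fin m → F)) : AddCommGroup (Red Λ) := by
  unfold Red; infer_instance

instance (Λ : Submodule ↥(OF F) (Fin m → F)) : Module ↥(OF F) (Red Λ) := by
  unfold Red; infer_instance

/-- The endomorphism of the reduction `Λ/𝔪Λ` induced by a stabilizing matrix. -/
def redMap (Λ : Submodule ↥(OF F) (Fin m → F)) (g : Matrix (Fin m) (Fin m) F)
    (h : MStab Λ g) : Red Λ →ₗ[↥(OF F)] Red Λ :=
  Submodule.mapQ _ _ (latMap Λ g h)
    (Submodule.smul_le.2 fun r hr x _ => Submodule.mem_comap.2 (by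
      rw [LinearMap.map_smul]
      exact Submodule.smul_mem_smul hr Submodule.mem_top))

/-- `Γ` acts semisimply on the `F`-subspace `W` (every `Γ`-stable subspace of `W` has a
`Γ`-stable complement in `W`). -/
def SSonSub (Γ : Subgroup (GL (Fin m) F)) (W : Submodule F (Fin m → F)) : Prop :=
  ∀ U : Submodule F (Fin m → F), U ≤ W →
    (∀ g ∈ Γ, ∀ x ∈ U, ((g : Matrix (Fin m) (Fin m) F)).mulVecLin x ∈ U) →
    ∃ U' : Submodule F (Fin m → F), U' ≤ W ∧
      (∀ g ∈ Γ, ∀ x ∈ U', ((g : Matrix (Fin m) (Fin m) F)).mulVecLin x ∈ U') ∧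
      U ⊓ U' = ⊥ ∧ U ⊔ U' = W

/-- `Γ` acts semisimply on the reduction `Λ/𝔪Λ`. -/
def SSonRed (Γ : Subgroup (GL (Fin m) F)) (Λ : Submodule ↥(OF F) (Fin m → F))
    (hst : ∀ g ∈ Γ, MStab Λ (g : Matrix (Fin m) (Fin m) F)) : Prop :=
  ∀ U : Submodule ↥(OF F) (Red Λ),
    (∀ g (hg : g ∈ Γ), ∀ x ∈ U, redMap Λ _ (hst g hg) x ∈ U) →
    ∃ U' : Submodule ↥(OF F) (Red Λ),
      (∀ g (hg : g ∈ Γ), ∀ x ∈ U', redMap Λ _ (hst g hg) x ∈ U') ∧ IsCompl U U'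

/-- The commutant `End_Γ(Λ/𝔪Λ)` of `Γ` acting on the reduction of the lattice `Λ`. -/
def RedEnd (Γ : Subgroup (GL (Fin m) F)) (Λ : Submodule ↥(OF F) (Fin m → F))
    (hst : ∀ g ∈ Γ, MStab Λ (g : Matrix (Fin m) (Fin m) F)) : Type :=
  {f : Red Λ →ₗ[↥(OF F)] Red Λ //
    ∀ g (hg : g ∈ Γ), f ∘ₗ redMap Λ _ (hst g hg) = redMap Λ _ (hst g hg) ∘ₗ f}

/-- The image of `Γ` in `End_F(W)` for a `Γ`-stable subspace `W ≤ F^m`. -/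
def restrictedAction (Γ : Subgroup (GL (Fin m) F)) (W : Submodule F (Fin m → F)) :
    Set (Module.End F ↥W) :=
  {f | ∃ g ∈ Γ, ∃ h : ∀ x ∈ W, ((g : Matrix (Fin m) (Fin m) F)).mulVecLin x ∈ W,
    f = LinearMap.restrict ((g : Matrix (Fin m) (Fin m) F)).mulVecLin h}

/-- The dimension over `F` of the centralizer of a set of endomorphisms. -/
def endCommDim (F M : Type) [Field F] [AddCommGroup M] [Module F M]
    (S : Set (Module.End F M)) : ℕ :=
  Module.finrank F (Subalgebra.centralizer F S : Subalgebra F (Module.End F M))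

/-- `dim_F End_Γ(W)`, the dimension of the commutant of `Γ` acting on `W`. -/
def commDim (Γ : Subgroup (GL (Fin m) F)) (W : Submodule F (Fin m → F)) : ℕ :=
  endCommDim F ↥W (restrictedAction Γ W)

section FiniteModules

variable {R : Type*} [Ring R]
variable {A B N N' X Y : Type*} [AddCommGroup A] [AddCommGroup B] [AddCommGroup N]
  [AddCommGroup N'] [AddCommGroup X] [AddCommGroup Y] [Module R A] [Module R B] [Module R N]
  [Module R N'] [Module R X] [Module R Y]

instance linearMap_finite [Finite X] [Finite Y] : Finite (X →ₗ[R] Y) := DFunLike.finite _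

lemma natCard_le_of_ker_le_range {G K L : Type*} [AddCommGroup G] [AddCommGroup K]
    [AddCommGroup L] [Finite K] [Finite L] (φ : G →+ K) (ψ : L →+ G) (h : φ.ker ≤ ψ.range) :
    Nat.card G ≤ Nat.card L * Nat.card K ∧
      (Nat.card L * Nat.card K ≤ Nat.card G → Function.Surjective φ) := by
  have hfin : Finite ψ.range := Set.finite_range ψ
  have hker : Nat.card φ.ker ≤ Nat.card L :=
    (Nat.card_le_card_of_injective _ (AddSubgroup.inclusion_injective h)).trans
      (Nat.card_le_card_of_surjective _ ψ.rangeRestrict_surjective)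
  have hran : Nat.card φ.range ≤ Nat.card K := AddSubgroup.card_le_card_addGroup _
  have hG : Nat.card G = Nat.card φ.ker * Nat.card φ.range := by
    rw [φ.ker.card_eq_card_quotient_mul_card_addSubgroup, mul_comm,
      Nat.card_congr (QuotientAddGroup.quotientKerEquivRange φ).toEquiv]
  refine ⟨hG ▸ Nat.mul_le_mul hker hran, fun hle => ?_⟩
  have hpos : 0 < Nat.card L := Nat.card_pos
  have hK : Nat.card K ≤ Nat.card φ.range := by
    rw [hG] at hle
    exact Nat.le_of_mul_le_mul_left (hle.trans (Nat.mul_le_mul_right _ hker)) hpos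
  exact AddMonoidHom.range_eq_top.1 (AddSubgroup.eq_top_of_le_card _ hK)

/-- The map `Hom(X, N) → Hom(X, B)` induced by `g : N → B`. -/
abbrev postcomp (X : Type*) [AddCommGroup X] [Module R X] (g : N →ₗ[R] B) :
    (X →ₗ[R] N) →+ (X →ₗ[R] B) :=
  AddMonoidHom.mk' (fun h => g ∘ₗ h) (fun _ _ => LinearMap.comp_add ..)

/-- The map `Hom(N, Y) → Hom(A, Y)` induced by `f : A → N`. -/
abbrev precomp (Y : Type*) [AddCommGroup Y] [Module R Y] (f : A →ₗ[R] N) :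
    (N →ₗ[R] Y) →+ (A →ₗ[R] Y) :=
  AddMonoidHom.mk' (fun h => h ∘ₗ f) (fun _ _ => LinearMap.add_comp ..)

lemma ker_postcomp_le {f : A →ₗ[R] N} {g : N →ₗ[R] B} (hf : Function.Injective f)
    (hfg : Function.Exact f g) : (postcomp X g).ker ≤ (postcomp X f).range := by
  intro h hh
  have hh' : ∀ x, h x ∈ LinearMap.range f := fun x => (hfg _).1 (LinearMap.congr_fun hh x)
  refine ⟨(LinearEquiv.ofInjective f hf).symm.toLinearMap ∘ₗ h.codRestrict _ hh', ?_⟩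
  ext x
  exact congrArg Subtype.val ((LinearEquiv.ofInjective f hf).apply_symm_apply ⟨h x, hh' x⟩)

lemma ker_precomp_le {f : A →ₗ[R] N} {g : N →ₗ[R] B} (hg : Function.Surjective g)
    (hfg : Function.Exact f g) : (precomp Y f).ker ≤ (precomp Y g).range := by
  intro h hh
  have hker : LinearMap.ker g ≤ LinearMap.ker h := by
    intro x hx
    obtain ⟨a, rfl⟩ := (hfg x).1 hx
    exact LinearMap.congr_fun hh a
  refine ⟨(LinearMap.ker g).liftQ h hker ∘ₗ
    (g.quotKerEquivOfSurjective hg).symm.toLinearMap, ?_⟩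
  ext x
  have : (g.quotKerEquivOfSurjective hg).symm (g x) = Submodule.Quotient.mk x := by
    rw [LinearEquiv.symm_apply_eq]; rfl
  simp [this]

lemma natCard_linearMap_prod_prod :
    Nat.card (A × B →ₗ[R] X × Y) =
      (Nat.card (B →ₗ[R] X) * Nat.card (B →ₗ[R] Y)) *
        (Nat.card (A →ₗ[R] X) * Nat.card (A →ₗ[R] Y)) := by
  rw [← Nat.card_congr (LinearMap.coprodEquiv ℕ (R := R)).toEquiv, Nat.card_prod,
      ← Nat.card_congr (LinearMap.prodEquiv ℕ (R := R)).toEquiv,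
      ← Nat.card_congr (LinearMap.prodEquiv ℕ (R := R)).toEquiv, Nat.card_prod, Nat.card_prod,
      mul_comm]

/-- A short exact sequence of finite modules whose middle term has at least as many endomorphisms
as the direct sum of the outer terms is split. -/
lemma exists_section_of_natCard_end_le [Finite A] [Finite B] [Finite N]
    {f : A →ₗ[R] N} {g : N →ₗ[R] B} (hf : Function.Injective f) (hg : Function.Surjective g)
    (hfg : Function.Exact f g)
    (hcard : Nat.card (A × B →ₗ[R] A × B) ≤ Nat.card (N →ₗ[R] N)) :
    ∃ s : B →ₗ[R] N, g ∘ₗ s = LinearMap.id := by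
  rw [natCard_linearMap_prod_prod] at hcard
  have h₁ := natCard_le_of_ker_le_range _ _ (ker_precomp_le (Y := N) hg hfg)
  have h₂ := natCard_le_of_ker_le_range _ _ (ker_postcomp_le (X := A) hf hfg)
  have h₃ := natCard_le_of_ker_le_range _ _ (ker_postcomp_le (X := B) hf hfg)
  refine h₃.2 ?_ LinearMap.id
  have hpos : 0 < Nat.card (A →ₗ[R] A) * Nat.card (A →ₗ[R] B) :=
    Nat.mul_pos Nat.card_pos Nat.card_pos
  exact Nat.le_of_mul_le_mul_right (hcard.trans (h₁.1.trans (Nat.mul_le_mul_left _ h₂.1))) hpos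

lemma nonempty_equiv_prod_of_section {f : A →ₗ[R] N} {g : N →ₗ[R] B} (hf : Function.Injective f)
    (hfg : Function.Exact f g) (h : ∃ s : B →ₗ[R] N, g ∘ₗ s = LinearMap.id) :
    Nonempty (N ≃ₗ[R] A × B) :=
  ⟨(hfg.splitSurjectiveEquiv hf ⟨h.choose, h.choose_spec⟩).1⟩

/-- If a semisimple finite module is an extension of `B` by `A`, then any extension of `A` by `B`
with at least as many endomorphisms is isomorphic to it. -/
lemma nonempty_equiv_of_swapped_extension [Finite A] [Finite B] [Finite N] [Finite N']
    [IsSemisimpleModule R N] {f : A →ₗ[R] N} {g : N →ₗ[R] B} (hf : Function.Injective f)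
    (hg : Function.Surjective g) (hfg : Function.Exact f g)
    {f' : B →ₗ[R] N'} {g' : N' →ₗ[R] A} (hf' : Function.Injective f')
    (hg' : Function.Surjective g') (hfg' : Function.Exact f' g')
    (hcard : Nat.card (N →ₗ[R] N) ≤ Nat.card (N' →ₗ[R] N')) : Nonempty (N ≃ₗ[R] N') := by
  obtain ⟨e⟩ := nonempty_equiv_prod_of_section hf hfg
    (IsSemisimpleModule.lifting_property g hg LinearMap.id)
  have hN : Nat.card (B × A →ₗ[R] B × A) = Nat.card (N →ₗ[R] N) :=
    Nat.card_congr
      ((LinearEquiv.prodComm R B A).trans e.symm).conjRingEquiv.toEquiv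
  obtain ⟨e'⟩ := nonempty_equiv_prod_of_section hf' hfg'
    (exists_section_of_natCard_end_le hf' hg' hfg' (hN.trans_le hcard))
  exact ⟨e.trans ((LinearEquiv.prodComm R A B).trans e'.symm)⟩

end FiniteModules

section Reduction

variable {O R : Type*} [CommRing O] [Ring R] [Algebra O R]

/-- The reduction `X/πX` of an `R`-module, where `π` is a scalar of the base ring. -/
abbrev Reduction (R : Type*) [Ring R] [Algebra O R] (π : O) (X : Type*) [AddCommGroup X]
    [Module O X] [Module R X] [IsScalarTower O R X] : Type _ :=
  X ⧸ LinearMap.range (π • (LinearMap.id : X →ₗ[R] X))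

variable {π : O} {X Y Z : Type*} [AddCommGroup X] [AddCommGroup Y] [AddCommGroup Z]
  [Module O X] [Module R X] [IsScalarTower O R X] [Module O Y] [Module R Y] [IsScalarTower O R Y]
  [Module O Z] [Module R Z] [IsScalarTower O R Z]

lemma Reduction.mk_eq_zero_iff (x : X) :
    (Submodule.Quotient.mk x : Reduction R π X) = 0 ↔ ∃ y : X, π • y = x :=
  Submodule.Quotient.mk_eq_zero _

lemma Reduction.finite [Finite (O ⧸ Ideal.span {π})] [Module.Finite O X] :
    Finite (Reduction R π X) := by
  have : Finite (X ⧸ (⊤ : Submodule O X)) := inferInstance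
  have h := Submodule.finite_quotient_smul (I := Ideal.span {π}) (N := (⊤ : Submodule O X))
    Module.Finite.fg_top
  refine Finite.of_surjective
    (Submodule.liftQ _ ((Submodule.mkQ (LinearMap.range
      (π • (LinearMap.id : X →ₗ[R] X)))).restrictScalars O) ?_ :
        (X ⧸ Ideal.span {π} • (⊤ : Submodule O X)) → Reduction R π X) ?_
  · rw [Submodule.ideal_span_singleton_smul]
    rintro _ ⟨x, -, rfl⟩
    exact (Reduction.mk_eq_zero_iff _).2 ⟨x, rfl⟩
  · intro y
    obtain ⟨x, rfl⟩ := Submodule.Quotient.mk_surjective _ y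
    exact ⟨Submodule.Quotient.mk x, rfl⟩

/-- The map induced on reductions. -/
def Reduction.map (π : O) (f : X →ₗ[R] Y) : Reduction R π X →ₗ[R] Reduction R π Y :=
  Submodule.mapQ _ _ f (by
    rintro _ ⟨x, rfl⟩
    exact ⟨f x, by simp [LinearMap.map_smul_of_tower]⟩)

@[simp] lemma Reduction.map_mk (f : X →ₗ[R] Y) (x : X) :
    Reduction.map π f (Submodule.Quotient.mk x) = Submodule.Quotient.mk (f x) := rfl

/-- Isomorphic modules have isomorphic reductions. -/
def Reduction.congr (π : O) (e : X ≃ₗ[R] Y) : Reduction R π X ≃ₗ[R] Reduction R π Y :=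
  LinearEquiv.ofLinearMap (Reduction.map π e.toLinearMap) (Reduction.map π e.symm.toLinearMap)
    (by ext; simp) (by ext; simp)

/-- Reduction commutes with binary products. -/
def Reduction.prodEquiv (π : O) :
    Reduction R π (X × Y) ≃ₗ[R] Reduction R π X × Reduction R π Y :=
  LinearEquiv.ofLinearMap
    ((Reduction.map π (LinearMap.fst R X Y)).prod (Reduction.map π (LinearMap.snd R X Y)))
    ((Reduction.map π (LinearMap.inl R X Y)).coprod (Reduction.map π (LinearMap.inr R X Y)))
    (by ext <;> simp) (by ext <;> simp)

variable [IsDomain O] [IsPrincipalIdealRing O]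

lemma linearMap_finite_over [Module.Finite O X] [Module.IsTorsionFree O X] [Module.Finite O Y]
    [Module.IsTorsionFree O Y] : Module.Finite O (X →ₗ[R] Y) :=
  Module.Finite.of_injective (LinearMap.restrictScalarsₗ O R X Y O)
    (LinearMap.restrictScalars_injective O)

omit [Module O X] [IsScalarTower O R X] [IsDomain O] [IsPrincipalIdealRing O] in
lemma linearMap_isTorsionFree [Module.IsTorsionFree O Y] : Module.IsTorsionFree O (X →ₗ[R] Y) :=
  Function.Injective.moduleIsTorsionFree (fun f : X →ₗ[R] Y => (f : X → Y))
    DFunLike.coe_injective (fun _ _ => rfl)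

omit [IsPrincipalIdealRing O] in
lemma eq_smul_of_reductionMap_eq_zero [Module.IsTorsionFree O Y] (hπ : π ≠ 0) (f : X →ₗ[R] Y)
    (hf : Reduction.map π f = 0) : ∃ g : X →ₗ[R] Y, f = π • g := by
  have hinj : Function.Injective (π • (LinearMap.id : Y →ₗ[R] Y)) := smul_right_injective Y hπ
  have hr : ∀ x, f x ∈ LinearMap.range (π • (LinearMap.id : Y →ₗ[R] Y)) := fun x =>
    (Reduction.mk_eq_zero_iff _).1 (LinearMap.congr_fun hf (Submodule.Quotient.mk x))
  refine ⟨(LinearEquiv.ofInjective _ hinj).symm.toLinearMap ∘ₗ f.codRestrict _ hr, ?_⟩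
  ext x
  exact (congrArg Subtype.val ((LinearEquiv.ofInjective _ hinj).apply_symm_apply ⟨f x, hr x⟩)).symm

/-- Reduction can only enlarge spaces of homomorphisms. -/
lemma pow_finrank_le_natCard_reduction [Module.Finite O X] [Module.IsTorsionFree O X]
    [Module.Finite O Y] [Module.IsTorsionFree O Y] [Finite (O ⧸ Ideal.span {π})] (hπ : π ≠ 0) :
    Nat.card (O ⧸ Ideal.span {π}) ^ Module.finrank O (X →ₗ[R] Y) ≤
      Nat.card (Reduction R π X →ₗ[R] Reduction R π Y) := by
  have := Reduction.finite (R := R) (π := π) (X := X)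
  have := Reduction.finite (R := R) (π := π) (X := Y)
  have := linearMap_finite_over (O := O) (R := R) (X := X) (Y := Y)
  have := linearMap_isTorsionFree (O := O) (R := R) (X := X) (Y := Y)
  let b := Module.finBasis O (X →ₗ[R] Y)
  have hcard : Nat.card (Fin (Module.finrank O (X →ₗ[R] Y)) → O ⧸ Ideal.span {π}) =
      Nat.card (O ⧸ Ideal.span {π}) ^ Module.finrank O (X →ₗ[R] Y) := by
    rw [Nat.card_fun, Nat.card_fin]
  rw [← hcard]
  refine Nat.card_le_card_of_injective
    (fun c => Reduction.map π (b.equivFun.symm fun i => (c i).out)) fun c c' hcc => ?_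
  obtain ⟨g, hg⟩ := eq_smul_of_reductionMap_eq_zero hπ
    (b.equivFun.symm (fun i => (c i).out) - b.equivFun.symm fun i => (c' i).out) (by
      ext x
      have := LinearMap.congr_fun hcc (Submodule.Quotient.mk x)
      simpa [sub_eq_zero] using this)
  ext i
  have hi := congrFun (congrArg b.equivFun hg) i
  rw [map_sub, map_smul, LinearEquiv.apply_symm_apply, LinearEquiv.apply_symm_apply] at hi
  rw [← Quotient.out_eq (c i), ← Quotient.out_eq (c' i)]
  exact Ideal.Quotient.eq.2 (Ideal.mem_span_singleton'.2 ⟨b.equivFun g i, by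
    rw [mul_comm]; exact hi.symm⟩)

variable (R π X) in
/-- The reduction of `X` is semisimple and its endomorphism algebra has the smallest possible
size. -/
def HasOptimalReduction : Prop :=
  IsSemisimpleModule R (Reduction R π X) ∧
    Nat.card (Reduction R π X →ₗ[R] Reduction R π X) =
      Nat.card (O ⧸ Ideal.span {π}) ^ Module.finrank O (X →ₗ[R] X)

omit [IsDomain O] [IsPrincipalIdealRing O] in
lemma HasOptimalReduction.congr (e : X ≃ₗ[R] Y) (h : HasOptimalReduction R π X) :
    HasOptimalReduction R π Y := by
  have := h.1
  refine ⟨IsSemisimpleModule.congr (Reduction.congr π e).symm, ?_⟩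
  rw [← Nat.card_congr (Reduction.congr π e).conjRingEquiv.toEquiv]
  refine h.2.trans (congrArg _ ?_)
  have e' : (X →ₗ[R] X) ≃ₗ[O] (Y →ₗ[R] Y) :=
    (e.conjRingEquiv : (X →ₗ[R] X) ≃+ (Y →ₗ[R] Y)).toLinearEquiv fun c f => by
      ext y; exact e.toLinearMap.map_smul_of_tower c _
  exact e'.finrank_eq

section Step

variable [Module.Finite O X] [Module.IsTorsionFree O X]
    [Module.Finite O Y] [Module.IsTorsionFree O Y]

omit [Module.Finite O X] in
/-- An inclusion with a quasi-inverse induces an embedding of endomorphism rings. -/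
lemma finrank_end_le_of_comp_eq_smul (hπ : π ≠ 0) (i : Y →ₗ[R] X) (p : X →ₗ[R] Y)
    (hip : i ∘ₗ p = π • LinearMap.id) :
    Module.finrank O (X →ₗ[R] X) ≤ Module.finrank O (Y →ₗ[R] Y) := by
  have := linearMap_finite_over (O := O) (R := R) (X := Y) (Y := Y)
  let φ : (X →ₗ[R] X) →ₗ[O] (Y →ₗ[R] Y) :=
    { toFun := fun f => p ∘ₗ f ∘ₗ i
      map_add' := fun f g => by ext; simp
      map_smul' := fun c f => by ext; simp [LinearMap.map_smul_of_tower] }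
  refine LinearMap.finrank_le_finrank_of_injective (f := φ) ?_
  have hφ : ∀ f, i ∘ₗ φ f ∘ₗ p = (π * π) • f := fun f => by
    ext x
    have h₁ : ∀ x, i (p x) = π • x := LinearMap.congr_fun hip
    simp [φ, h₁, LinearMap.map_smul_of_tower, mul_smul]
  intro f g hfg
  have : (π * π) • f = (π * π) • g := by rw [← hφ, ← hφ, hfg]
  ext x
  exact smul_right_injective X (mul_ne_zero hπ hπ) (LinearMap.congr_fun this x)

omit [Module.Finite O X] [Module.IsTorsionFree O X] [Module.Finite O Y]
  [Module.IsTorsionFree O Y] [IsDomain O] [IsPrincipalIdealRing O] in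
lemma exists_reduction_extension (i : Y →ₗ[R] X) (p : X →ₗ[R] Y) (hi : Function.Injective i)
    (hip : i ∘ₗ p = π • LinearMap.id) (hpi : p ∘ₗ i = π • LinearMap.id) :
    ∃ (f : (Y ⧸ LinearMap.range p) →ₗ[R] Reduction R π X)
      (g : Reduction R π X →ₗ[R] X ⧸ LinearMap.range i),
      Function.Injective f ∧ Function.Surjective g ∧ Function.Exact f g := by
  have hip' : ∀ x, i (p x) = π • x := LinearMap.congr_fun hip
  have hpi' : ∀ y, p (i y) = π • y := LinearMap.congr_fun hpi
  refine ⟨Submodule.liftQ _ (Submodule.mkQ _ ∘ₗ i) ?_, Submodule.liftQ _ (Submodule.mkQ _) ?_,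
    ?_, ?_, ?_⟩
  · rintro _ ⟨x, rfl⟩
    exact (Reduction.mk_eq_zero_iff _).2 ⟨x, (hip' x).symm⟩
  · rintro _ ⟨x, rfl⟩
    rw [Submodule.ker_mkQ]
    exact ⟨p x, hip' x⟩
  · rw [injective_iff_map_eq_zero]
    intro y
    obtain ⟨y, rfl⟩ := Submodule.Quotient.mk_surjective _ y
    intro hy
    obtain ⟨x, hx⟩ := (Reduction.mk_eq_zero_iff _).1 hy
    exact (Submodule.Quotient.mk_eq_zero _).2 ⟨x, hi ((hip' x).trans hx)⟩
  · intro x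
    obtain ⟨x, rfl⟩ := Submodule.Quotient.mk_surjective _ x
    exact ⟨Submodule.Quotient.mk x, rfl⟩
  · intro x
    obtain ⟨x, rfl⟩ := Submodule.Quotient.mk_surjective _ x
    constructor
    · intro hx
      obtain ⟨y, rfl⟩ := (Submodule.Quotient.mk_eq_zero _).1 hx
      exact ⟨Submodule.Quotient.mk y, rfl⟩
    · rintro ⟨y, hy⟩
      obtain ⟨y, rfl⟩ := Submodule.Quotient.mk_surjective _ y
      rw [← hy]
      exact (Submodule.Quotient.mk_eq_zero _).2 ⟨y, rfl⟩

lemma HasOptimalReduction.of_comp_eq_smul [Finite (O ⧸ Ideal.span {π})] (hπ : π ≠ 0)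
    (i : Y →ₗ[R] X) (p : X →ₗ[R] Y)
    (hip : i ∘ₗ p = π • LinearMap.id) (hpi : p ∘ₗ i = π • LinearMap.id)
    (h : HasOptimalReduction R π X) : HasOptimalReduction R π Y := by
  have := h.1
  have := Reduction.finite (R := R) (π := π) (X := X)
  have := Reduction.finite (R := R) (π := π) (X := Y)
  have hip' : ∀ x, i (p x) = π • x := LinearMap.congr_fun hip
  have hpi' : ∀ y, p (i y) = π • y := LinearMap.congr_fun hpi
  have hi : Function.Injective i := fun y y' hy =>
    smul_right_injective Y hπ (by simp only [← hpi', hy])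
  have hp : Function.Injective p := fun x x' hx =>
    smul_right_injective X hπ (by simp only [← hip', hx])
  have hrank : Module.finrank O (X →ₗ[R] X) = Module.finrank O (Y →ₗ[R] Y) :=
    (finrank_end_le_of_comp_eq_smul hπ i p hip).antisymm
      (finrank_end_le_of_comp_eq_smul hπ p i hpi)
  obtain ⟨f, g, hf, hg, hfg⟩ := exists_reduction_extension i p hi hip hpi
  obtain ⟨f', g', hf', hg', hfg'⟩ := exists_reduction_extension p i hp hpi hip
  have : Finite (X ⧸ LinearMap.range i) := Finite.of_surjective g hg
  have : Finite (Y ⧸ LinearMap.range p) := Finite.of_surjective g' hg'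
  obtain ⟨e⟩ := nonempty_equiv_of_swapped_extension hf hg hfg hf' hg' hfg' (by
    rw [h.2, hrank]
    exact pow_finrank_le_natCard_reduction hπ)
  refine ⟨IsSemisimpleModule.congr e.symm, ?_⟩
  rw [← Nat.card_congr e.conjRingEquiv.toEquiv, ← hrank]
  exact h.2

lemma HasOptimalReduction.of_prod [Finite (O ⧸ Ideal.span {π})] (hπ : π ≠ 0)
    (h : HasOptimalReduction R π (X × Y)) : HasOptimalReduction R π X := by
  have := h.1
  have := Reduction.finite (R := R) (π := π) (X := X)
  have := Reduction.finite (R := R) (π := π) (X := Y)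
  have hss : IsSemisimpleModule R (Reduction R π X × Reduction R π Y) :=
    IsSemisimpleModule.congr (Reduction.prodEquiv π).symm
  refine ⟨IsSemisimpleModule.of_injective (LinearMap.inl R (Reduction R π X) (Reduction R π Y))
    LinearMap.inl_injective, ?_⟩
  have hcard := h.2
  rw [Nat.card_congr (Reduction.prodEquiv (R := R) (X := X) (Y := Y) π).conjRingEquiv.toEquiv,
    Module.End, natCard_linearMap_prod_prod] at hcard
  have := linearMap_finite_over (O := O) (R := R) (X := X) (Y := X)
  have := linearMap_finite_over (O := O) (R := R) (X := X) (Y := Y)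
  have := linearMap_finite_over (O := O) (R := R) (X := Y) (Y := X)
  have := linearMap_finite_over (O := O) (R := R) (X := Y) (Y := Y)
  have := linearMap_isTorsionFree (O := O) (R := R) (X := X) (Y := X)
  have := linearMap_isTorsionFree (O := O) (R := R) (X := X) (Y := Y)
  have := linearMap_isTorsionFree (O := O) (R := R) (X := Y) (Y := X)
  have := linearMap_isTorsionFree (O := O) (R := R) (X := Y) (Y := Y)
  have hrank : Module.finrank O (X × Y →ₗ[R] X × Y) =
      (Module.finrank O (Y →ₗ[R] X) + Module.finrank O (Y →ₗ[R] Y)) +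
        (Module.finrank O (X →ₗ[R] X) + Module.finrank O (X →ₗ[R] Y)) := by
    rw [← (((LinearMap.prodEquiv O (R := R)).prodCongr (LinearMap.prodEquiv O (R := R))).trans
      (LinearMap.coprodEquiv O (R := R))).finrank_eq, Module.finrank_prod, Module.finrank_prod,
      Module.finrank_prod, add_comm]
  rw [hrank, pow_add, pow_add, pow_add] at hcard
  have hq : 0 < Nat.card (O ⧸ Ideal.span {π}) := Nat.card_pos
  have bXX := pow_finrank_le_natCard_reduction (R := R) (X := X) (Y := X) hπ
  have bXY := pow_finrank_le_natCard_reduction (R := R) (X := X) (Y := Y) hπ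
  have bYX := pow_finrank_le_natCard_reduction (R := R) (X := Y) (Y := X) hπ
  have bYY := pow_finrank_le_natCard_reduction (R := R) (X := Y) (Y := Y) hπ
  have hX := Nat.le_of_mul_le_mul_left
    ((Nat.mul_le_mul_right _ (Nat.mul_le_mul bYX bYY)).trans_eq hcard)
    (Nat.mul_pos (pow_pos hq _) (pow_pos hq _))
  exact (Nat.le_of_mul_le_mul_right ((Nat.mul_le_mul_left _ bXY).trans hX)
    (pow_pos hq _)).antisymm bXX

omit [Module.IsTorsionFree O X] in
lemma finite_submodule (Λ : Submodule R X) : Module.Finite O Λ :=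
  Module.Finite.of_injective (Λ.subtype.restrictScalars O) Λ.subtype_injective

omit [IsDomain O] [IsPrincipalIdealRing O] [Module.Finite O X] in
lemma isTorsionFree_submodule (Λ : Submodule R X) : Module.IsTorsionFree O Λ :=
  Function.Injective.moduleIsTorsionFree (fun x : Λ => (x : X)) Subtype.val_injective
    (fun _ _ => rfl)

lemma HasOptimalReduction.of_neighbor [Finite (O ⧸ Ideal.span {π})] (hπ : π ≠ 0)
    {L M : Submodule R X} (hML : M ≤ L) (hLM : ∀ x ∈ L, π • x ∈ M)
    (h : HasOptimalReduction R π L) : HasOptimalReduction R π M := by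
  have := finite_submodule (O := O) L
  have := finite_submodule (O := O) M
  have := isTorsionFree_submodule (O := O) L
  have := isTorsionFree_submodule (O := O) M
  exact h.of_comp_eq_smul hπ (Submodule.inclusion hML)
    ((π • L.subtype).codRestrict M fun x => hLM x x.2) (by ext; rfl) (by ext; rfl)

lemma HasOptimalReduction.of_pow_smul_mem [Finite (O ⧸ Ideal.span {π})] (hπ : π ≠ 0)
    (h : HasOptimalReduction R π X) (Λ : Submodule R X) (n : ℕ) (hΛ : ∀ x : X, π ^ n • x ∈ Λ) :
    HasOptimalReduction R π Λ := by
  have key : ∀ k : ℕ, HasOptimalReduction R π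
      ↥(Λ ⊔ LinearMap.range (π ^ k • (LinearMap.id : X →ₗ[R] X))) := by
    intro k
    induction k with
    | zero =>
      have : Λ ⊔ LinearMap.range (π ^ 0 • (LinearMap.id : X →ₗ[R] X)) = ⊤ := by simp
      rw [this]
      exact h.congr Submodule.topEquiv.symm
    | succ k ih =>
      refine ih.of_neighbor hπ (sup_le_sup_left ?_ _) ?_
      · rintro _ ⟨x, rfl⟩
        exact ⟨π • x, by simp [pow_succ, mul_smul]⟩
      · intro x hx
        obtain ⟨y, hy, _, ⟨z, rfl⟩, rfl⟩ := Submodule.mem_sup.1 hx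
        rw [smul_add]
        refine Submodule.add_mem_sup (Submodule.smul_of_tower_mem _ _ hy) ⟨z, ?_⟩
        simp [pow_succ', mul_smul]
  have := key n
  rwa [sup_eq_left.2] at this
  rintro _ ⟨x, rfl⟩
  exact hΛ x

/-- Optimality of the reduction passes to modules commensurable with the given one. -/
lemma HasOptimalReduction.of_injective [Finite (O ⧸ Ideal.span {π})] (hπ : π ≠ 0)
    (h : HasOptimalReduction R π X) (i : Z →ₗ[R] X) (hi : Function.Injective i) (n : ℕ)
    (hn : ∀ x : X, ∃ z, i z = π ^ n • x) : HasOptimalReduction R π Z :=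
  (h.of_pow_smul_mem hπ (LinearMap.range i) n hn).congr (LinearEquiv.ofInjective i hi).symm

end Step

end Reduction

section Operators

variable {O R ι : Type*} [CommRing O] [Ring R] [Algebra O R] {γ : ι → R}
variable {M X Y : Type*} [AddCommGroup M] [Module O M] [AddCommGroup X] [AddCommGroup Y]
  [Module O X] [Module R X] [IsScalarTower O R X] [Module O Y] [Module R Y] [IsScalarTower O R Y]

lemma smul_mem_of_generators (hγ : Algebra.adjoin O (Set.range γ) = ⊤) (U : Submodule O X)
    (hU : ∀ i, ∀ x ∈ U, γ i • x ∈ U) (r : R) {x : X} (hx : x ∈ U) : r • x ∈ U := by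
  have hr : r ∈ Algebra.adjoin O (Set.range γ) := hγ ▸ Algebra.mem_top
  induction hr using Algebra.adjoin_induction generalizing x with
  | mem _ h => obtain ⟨i, rfl⟩ := h; exact hU i x hx
  | algebraMap a => rw [algebraMap_smul]; exact U.smul_mem a hx
  | add _ _ _ _ ha hb => rw [add_smul]; exact U.add_mem (ha hx) (hb hx)
  | mul _ _ _ _ ha hb => rw [mul_smul]; exact ha (hb hx)

/-- A submodule over the base ring stable under generators of the algebra, as a submodule over
the algebra. -/
def stableSubmodule (hγ : Algebra.adjoin O (Set.range γ) = ⊤) (U : Submodule O X)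
    (hU : ∀ i, ∀ x ∈ U, γ i • x ∈ U) : Submodule R X :=
  { U with smul_mem' := fun r _ hx => smul_mem_of_generators hγ U hU r hx }

lemma map_smul_of_generators (hγ : Algebra.adjoin O (Set.range γ) = ⊤) (f : X →ₗ[O] Y)
    (hf : ∀ i x, f (γ i • x) = γ i • f x) (r : R) (x : X) : f (r • x) = r • f x := by
  have hr : r ∈ Algebra.adjoin O (Set.range γ) := hγ ▸ Algebra.mem_top
  induction hr using Algebra.adjoin_induction generalizing x with
  | mem _ h => obtain ⟨i, rfl⟩ := h; exact hf i x
  | algebraMap a => rw [algebraMap_smul, algebraMap_smul, map_smul]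
  | add _ _ _ _ ha hb => rw [add_smul, add_smul, map_add, ha, hb]
  | mul _ _ _ _ ha hb => rw [mul_smul, mul_smul, ha, hb]

lemma isSemisimpleModule_iff_operators (hγ : Algebra.adjoin O (Set.range γ) = ⊤)
    (ρ : ι → M →ₗ[O] M) (e : M ≃ₗ[O] X) (he : ∀ i x, e (ρ i x) = γ i • e x) :
    IsSemisimpleModule R X ↔ ∀ U : Submodule O M, (∀ i, ∀ x ∈ U, ρ i x ∈ U) →
      ∃ U' : Submodule O M, (∀ i, ∀ x ∈ U', ρ i x ∈ U') ∧ IsCompl U U' := by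
  have hmap : ∀ U : Submodule O M, (∀ i, ∀ x ∈ U, ρ i x ∈ U) →
      ∀ i, ∀ x ∈ U.map e.toLinearMap, γ i • x ∈ U.map e.toLinearMap := by
    rintro U hU i _ ⟨x, hx, rfl⟩
    exact ⟨ρ i x, hU i x hx, he i x⟩
  have hcomap : ∀ (U : Submodule R X) (i), ∀ x ∈ (U.restrictScalars O).comap e.toLinearMap,
      ρ i x ∈ (U.restrictScalars O).comap e.toLinearMap := by
    intro U i x hx
    change e (ρ i x) ∈ U
    rw [he]
    exact U.smul_mem _ hx
  constructor
  · intro h U hU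
    obtain ⟨U', hc⟩ := exists_isCompl (stableSubmodule hγ _ (hmap U hU))
    refine ⟨(U'.restrictScalars O).comap e.toLinearMap, hcomap U', ?_⟩
    rw [isCompl_iff, Submodule.disjoint_def, codisjoint_iff, eq_top_iff] at hc ⊢
    refine ⟨fun x hx hx' => e.map_eq_zero_iff.1 (hc.1 _ ⟨x, hx, rfl⟩ hx'), fun x _ => ?_⟩
    obtain ⟨_, ⟨y, hy, rfl⟩, z, hz, hyz⟩ := Submodule.mem_sup.1 (hc.2 (Submodule.mem_top (x := e x)))
    refine Submodule.mem_sup.2 ⟨y, hy, e.symm z, by simpa using hz, e.injective ?_⟩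
    simpa using hyz
  · intro h
    refine (isSemisimpleModule_iff R X).2 ⟨fun U => ?_⟩
    obtain ⟨U', hU', hc⟩ := h _ (hcomap U)
    refine ⟨stableSubmodule hγ _ (hmap U' hU'), ?_⟩
    rw [isCompl_iff, Submodule.disjoint_def, codisjoint_iff, eq_top_iff] at hc ⊢
    refine ⟨?_, fun x _ => ?_⟩
    · rintro _ hx ⟨y, hy, rfl⟩
      exact e.map_eq_zero_iff.2 (hc.1 y hx hy)
    · obtain ⟨y, hy, z, hz, hyz⟩ := Submodule.mem_sup.1 (hc.2 (Submodule.mem_top (x := e.symm x)))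
      refine Submodule.mem_sup.2 ⟨e y, hy, e z, ⟨z, hz, rfl⟩, ?_⟩
      rw [← map_add, hyz, e.apply_symm_apply]

lemma natCard_commutant_eq (hγ : Algebra.adjoin O (Set.range γ) = ⊤)
    (ρ : ι → M →ₗ[O] M) (e : M ≃ₗ[O] X) (he : ∀ i x, e (ρ i x) = γ i • e x) :
    Nat.card {f : M →ₗ[O] M // ∀ i, f ∘ₗ ρ i = ρ i ∘ₗ f} = Nat.card (X →ₗ[R] X) := by
  have he' : ∀ i x, e.symm (γ i • x) = ρ i (e.symm x) := fun i x => by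
    rw [e.symm_apply_eq, he, e.apply_symm_apply]
  refine Nat.card_congr
    { toFun := fun f =>
        { toFun := fun x => e (f.1 (e.symm x))
          map_add' := fun x y => by simp
          map_smul' := fun r x => map_smul_of_generators hγ
            (e.toLinearMap ∘ₗ f.1 ∘ₗ e.symm.toLinearMap) (fun i x => by
              have := LinearMap.congr_fun (f.2 i) (e.symm x)
              simp only [LinearMap.comp_apply] at this
              simp [he', he, this]) r x }
      invFun := fun f => ⟨e.symm.toLinearMap ∘ₗ f.restrictScalars O ∘ₗ e.toLinearMap, fun i => by
        ext x
        simp [he, he']⟩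
      left_inv := fun f => by ext; simp
      right_inv := fun f => by ext; simp }

end Operators

section Denominators

variable {O K V : Type*} [CommRing O] [IsDomain O] [IsDiscreteValuationRing O] [Field K]
  [Algebra O K] [IsFractionRing O K] [AddCommGroup V] [Module O V] [Module K V]
  [IsScalarTower O K V] {π : O}

lemma exists_pow_smul_eq_algebraMap (hπ : Irreducible π) (a : K) :
    ∃ (n : ℕ) (b : O), π ^ n • a = algebraMap O K b := by
  obtain ⟨b, c, hc, rfl⟩ := IsFractionRing.div_surjective (A := O) a
  have hc0 := nonZeroDivisors.ne_zero hc
  obtain ⟨n, u, hu⟩ := IsDiscreteValuationRing.associated_pow_irreducible hc0 hπ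
  refine ⟨n, u * b, ?_⟩
  have : algebraMap O K c ≠ 0 := by simpa using hc0
  rw [← hu, Algebra.smul_def, map_mul, map_mul]
  field_simp

lemma exists_pow_smul_mem (hπ : Irreducible π) (Λ : Submodule O V) {x : V}
    (hx : x ∈ Submodule.span K (Λ : Set V)) : ∃ n : ℕ, π ^ n • x ∈ Λ := by
  induction hx using Submodule.span_induction with
  | mem x hx => exact ⟨0, by simpa using hx⟩
  | zero => exact ⟨0, by simp⟩
  | add x y _ _ hx hy =>
    obtain ⟨n, hn⟩ := hx
    obtain ⟨k, hk⟩ := hy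
    refine ⟨n + k, ?_⟩
    rw [smul_add]
    refine Λ.add_mem ?_ ?_
    · rw [add_comm, pow_add, mul_smul]; exact Λ.smul_mem _ hn
    · rw [pow_add, mul_smul]; exact Λ.smul_mem _ hk
  | smul a x _ hx =>
    obtain ⟨n, hn⟩ := hx
    obtain ⟨k, b, hb⟩ := exists_pow_smul_eq_algebraMap hπ a
    refine ⟨n + k, ?_⟩
    rw [pow_add, mul_smul, ← smul_assoc (π ^ k) a x, hb, algebraMap_smul, smul_comm]
    exact Λ.smul_mem _ hn

lemma exists_pow_smul_mem_of_fg (hπ : Irreducible π) (Λ : Submodule O V) {L : Submodule O V}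
    (hL : L.FG) (h : ∀ x ∈ L, x ∈ Submodule.span K (Λ : Set V)) :
    ∃ n : ℕ, ∀ x ∈ L, π ^ n • x ∈ Λ := by
  induction L, hL using Submodule.fg_induction with
  | singleton x =>
    obtain ⟨n, hn⟩ := exists_pow_smul_mem hπ Λ (h x (Submodule.mem_span_singleton_self x))
    refine ⟨n, fun y hy => ?_⟩
    obtain ⟨a, rfl⟩ := Submodule.mem_span_singleton.1 hy
    rw [smul_comm]
    exact Λ.smul_mem _ hn
  | sup L₁ L₂ _ _ h₁ h₂ =>
    obtain ⟨n, hn⟩ := h₁ fun x hx => h x (Submodule.mem_sup_left hx)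
    obtain ⟨k, hk⟩ := h₂ fun x hx => h x (Submodule.mem_sup_right hx)
    refine ⟨n + k, fun x hx => ?_⟩
    obtain ⟨y, hy, z, hz, rfl⟩ := Submodule.mem_sup.1 hx
    rw [smul_add]
    refine Λ.add_mem ?_ ?_
    · rw [add_comm, pow_add, mul_smul]; exact Λ.smul_mem _ (hn y hy)
    · rw [pow_add, mul_smul]; exact Λ.smul_mem _ (hk z hz)

variable (K) in
include K in
lemma isLocalizedModule_of_pow_smul (hπ : Irreducible π) {M : Type*} [AddCommGroup M]
    [Module O M] (j : M →ₗ[O] V) (hj : Function.Injective j)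
    (h : ∀ y, ∃ (n : ℕ) (x : M), π ^ n • y = j x) :
    IsLocalizedModule (nonZeroDivisors O) j where
  map_units s := by
    have hs : algebraMap O K s ≠ 0 := by simp
    rw [Module.End.isUnit_iff]
    refine ⟨fun x y hxy => ?_, fun y => ⟨(algebraMap O K s)⁻¹ • y, ?_⟩⟩
    · have : algebraMap O K s • x = algebraMap O K s • y := by
        rw [algebraMap_smul, algebraMap_smul]
        exact hxy
      exact smul_right_injective V hs this
    · change (s : O) • (algebraMap O K s)⁻¹ • y = y
      rw [← algebraMap_smul K, smul_inv_smul₀ hs]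
  surj y := by
    obtain ⟨n, x, hx⟩ := h y
    exact ⟨(x, ⟨π ^ n, mem_nonZeroDivisors_of_ne_zero (pow_ne_zero n hπ.ne_zero)⟩), hx⟩
  exists_of_eq hxy := ⟨1, by rw [hj hxy]⟩

/-- The endomorphisms of a lattice form a lattice in the endomorphisms of its span. -/
lemma finrank_commutant_eq {R L : Type*} [Ring R] [Algebra O R] [AddCommGroup L] [Module O L]
    [Module R L] [IsScalarTower O R L] [Module.Finite O L] (hπ : Irreducible π) (j : L →ₗ[O] V)
    (hj : Function.Injective j) (hspan : Submodule.span K (LinearMap.range j : Set V) = ⊤)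
    (C : Submodule K (V →ₗ[K] V))
    (hC : ∀ (c : V →ₗ[K] V) (f : L →ₗ[O] L), (∀ x, c (j x) = j (f x)) →
      (c ∈ C ↔ ∀ (r : R) x, f (r • x) = r • f x)) :
    Module.finrank K C = Module.finrank O (L →ₗ[R] L) := by
  have hloc : IsLocalizedModule (nonZeroDivisors O) j :=
    isLocalizedModule_of_pow_smul K hπ j hj fun y => by
      obtain ⟨n, x, hx⟩ := exists_pow_smul_mem (K := K) hπ (LinearMap.range j) (x := y)
        (hspan ▸ Submodule.mem_top)
      exact ⟨n, x, hx.symm⟩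
  let ext : (L →ₗ[O] L) →ₗ[O] (V →ₗ[K] V) :=
    IsLocalizedModule.mapExtendScalars (nonZeroDivisors O) j j K
  have hext : ∀ f x, ext f (j x) = j (f x) := fun f x =>
    IsLocalizedModule.map_apply (nonZeroDivisors O) j j f x
  let φ : (L →ₗ[R] L) →ₗ[O] C :=
    (ext ∘ₗ LinearMap.restrictScalarsₗ O R L L O).codRestrict (C.restrictScalars O) fun f =>
      (hC _ (f.restrictScalars O) (hext _)).2 fun r x => f.map_smul r x
  have hφ : ∀ f x, (φ f : V →ₗ[K] V) (j x) = j (f x) := fun f x => hext (f.restrictScalars O) x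
  have : IsLocalizedModule (nonZeroDivisors O) φ := by
    refine isLocalizedModule_of_pow_smul K hπ φ (fun f g hfg => ?_) fun c => ?_
    · ext x
      apply hj
      rw [← hφ, ← hφ, hfg]
    · obtain ⟨n, hn⟩ := exists_pow_smul_mem_of_fg (K := K) hπ (LinearMap.range j)
        (L := LinearMap.range ((c : V →ₗ[K] V).restrictScalars O ∘ₗ j))
        (Module.Finite.iff_fg.1 inferInstance) (fun _ _ => hspan ▸ Submodule.mem_top)
      choose f hf using fun x => hn _ ⟨x, rfl⟩
      have hf' : ∀ x, π ^ n • (c : V →ₗ[K] V) (j x) = j (f x) := fun x => (hf x).symm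
      let f₁ : L →ₗ[O] L :=
        { toFun := f
          map_add' := fun x y => hj (by simp only [map_add, ← hf', smul_add])
          map_smul' := fun a x => hj (by
            rw [RingHom.id_apply, map_smul, ← hf', ← hf', map_smul, smul_comm a,
              LinearMap.map_smul_of_tower]) }
      have hR := (hC (π ^ n • (c : V →ₗ[K] V)) f₁ hf').1
        ((C.restrictScalars O).smul_mem _ c.2)
      let f₂ : L →ₗ[R] L := { f₁ with map_smul' := hR }
      refine ⟨n, f₂, Subtype.ext (LinearMap.ext_on hspan ?_)⟩
      rintro _ ⟨x, rfl⟩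
      exact (hf' x).trans (hφ f₂ x).symm
  rw [IsFractionRing.finrank_right_eq O K C,
    IsLocalizedModule.finrank_eq (nonZeroDivisors O) φ le_rfl]

end Denominators

section Matrices

lemma zpowers_exp_neg_one :
    Subgroup.zpowers (Units.mk0 (WithZero.exp (-1 : ℤ)) WithZero.exp_ne_zero : Zm0ˣ) = ⊤ := by
  refine eq_top_iff.2 fun u _ =>
    Subgroup.mem_zpowers_iff.2 ⟨-WithZero.log (u : Zm0), Units.ext ?_⟩
  simp [← WithZero.exp_zsmul, WithZero.exp_log]

lemma isDiscreteValuationRing_OF (hdisc : Function.Surjective (Valued.v : F → Zm0)) :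
    IsDiscreteValuationRing ↥(OF F) := by
  have : (Valued.v : Valuation F Zm0).IsRankOneDiscrete := by
    refine ⟨Units.mk0 (WithZero.exp (-1 : ℤ)) WithZero.exp_ne_zero, ?_, ?_⟩
    · rw [zpowers_exp_neg_one, eq_comm, eq_top_iff]
      rintro u -
      obtain ⟨x, hx⟩ := hdisc u
      exact MonoidWithZeroHom.mem_valueGroup _ ⟨x, hx⟩
    · rw [← Units.val_lt_val, Units.val_mk0, Units.val_one, ← WithZero.exp_zero,
        WithZero.exp_lt_exp]
      decide
  unfold OF
  infer_instance

variable (Γ : Subgroup (GL (Fin m) F))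

/-- The operator on `F^m`, linear over the valuation ring, defined by an element of `Γ`. -/
def actionOperator (g : Γ) : Module.End ↥(OF F) (Fin m → F) :=
  ((g : GL (Fin m) F) : Matrix (Fin m) (Fin m) F).mulVecLin.restrictScalars ↥(OF F)

/-- The algebra over the valuation ring generated by the operators in `Γ`. -/
def ActionAlgebra : Type :=
  ↥(Algebra.adjoin ↥(OF F) (Set.range (actionOperator Γ)))

instance : Ring (ActionAlgebra Γ) :=
  inferInstanceAs (Ring ↥(Algebra.adjoin ↥(OF F) (Set.range (actionOperator Γ))))

instance : Algebra ↥(OF F) (ActionAlgebra Γ) :=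
  inferInstanceAs (Algebra ↥(OF F) ↥(Algebra.adjoin ↥(OF F) (Set.range (actionOperator Γ))))

/-- An element of `Γ` as an element of the algebra it generates. -/
def actionGenerator (g : Γ) : ActionAlgebra Γ :=
  (⟨actionOperator Γ g, Algebra.subset_adjoin ⟨g, rfl⟩⟩ :
    ↥(Algebra.adjoin ↥(OF F) (Set.range (actionOperator Γ))))

lemma adjoin_actionGenerator :
    Algebra.adjoin ↥(OF F) (Set.range (actionGenerator Γ)) = ⊤ := by
  refine Eq.trans ?_ (Algebra.adjoin_adjoin_coe_preimage (R := ↥(OF F))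
    (s := Set.range (actionOperator Γ)))
  congr 1
  ext x
  constructor
  · rintro ⟨g, rfl⟩
    exact ⟨g, rfl⟩
  · rintro ⟨g, hg⟩
    exact ⟨g, Subtype.ext hg⟩

variable {Γ}

lemma apply_mem_of_mem_adjoin {Λ : Submodule ↥(OF F) (Fin m → F)}
    (hst : ∀ g ∈ Γ, MStab Λ (g : Matrix (Fin m) (Fin m) F))
    (r : Module.End ↥(OF F) (Fin m → F))
    (hr : r ∈ Algebra.adjoin ↥(OF F) (Set.range (actionOperator Γ)))
    {x : Fin m → F} (hx : x ∈ Λ) : r x ∈ Λ := by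
  induction hr using Algebra.adjoin_induction generalizing x with
  | mem _ h => obtain ⟨g, rfl⟩ := h; exact hst _ g.2 x hx
  | algebraMap a => exact Λ.smul_mem a hx
  | add _ _ _ _ ha hb => exact Λ.add_mem (ha hx) (hb hx)
  | mul _ _ _ _ ha hb => exact ha (hb hx)

/-- A `Γ`-stable lattice, as a module over the algebra generated by `Γ`. -/
def StableLattice (Λ : Submodule ↥(OF F) (Fin m → F))
    (_ : ∀ g ∈ Γ, MStab Λ (g : Matrix (Fin m) (Fin m) F)) : Type := ↥Λ

variable {Λ : Submodule ↥(OF F) (Fin m → F)}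
  {hst : ∀ g ∈ Γ, MStab Λ (g : Matrix (Fin m) (Fin m) F)} {π : ↥(OF F)}

instance : AddCommGroup (StableLattice Λ hst) := inferInstanceAs (AddCommGroup ↥Λ)

instance : Module ↥(OF F) (StableLattice Λ hst) := inferInstanceAs (Module ↥(OF F) ↥Λ)

instance : Module (ActionAlgebra Γ) (StableLattice Λ hst) where
  smul r x := (⟨r.1 x.1, apply_mem_of_mem_adjoin hst r.1 r.2 x.2⟩ : ↥Λ)
  one_smul _ := rfl
  mul_smul _ _ _ := rfl
  smul_zero r := Subtype.ext (map_zero r.1)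
  smul_add r x y := Subtype.ext (map_add r.1 x.1 y.1)
  add_smul _ _ _ := rfl
  zero_smul _ := rfl

instance : IsScalarTower ↥(OF F) (ActionAlgebra Γ) (StableLattice Λ hst) where
  smul_assoc _ _ _ := rfl

/-- The inclusion of a stable lattice. -/
def StableLattice.incl : StableLattice Λ hst →ₗ[↥(OF F)] (Fin m → F) := Λ.subtype

lemma StableLattice.incl_injective : Function.Injective (incl (hst := hst)) :=
  Subtype.val_injective

lemma StableLattice.incl_mem (x : StableLattice Λ hst) : incl x ∈ Λ := x.2

lemma StableLattice.exists_incl_eq (hst : ∀ g ∈ Γ, MStab Λ (g : Matrix (Fin m) (Fin m) F))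
    {x : Fin m → F} (hx : x ∈ Λ) : ∃ y : StableLattice Λ hst, incl y = x :=
  ⟨(⟨x, hx⟩ : ↥Λ), rfl⟩

lemma StableLattice.incl_actionGenerator_smul (g : Γ) (x : StableLattice Λ hst) :
    incl (actionGenerator Γ g • x) =
      ((g : GL (Fin m) F) : Matrix (Fin m) (Fin m) F).mulVecLin (incl x) := rfl

/-- The two descriptions of the reduction of a stable lattice agree. -/
def redEquiv (hst : ∀ g ∈ Γ, MStab Λ (g : Matrix (Fin m) (Fin m) F))
    (hπ : maximalIdeal ↥(OF F) = Ideal.span {π}) :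
    Red Λ ≃ₗ[↥(OF F)] Reduction (ActionAlgebra Γ) π (StableLattice Λ hst) :=
  (Submodule.Quotient.equiv (maximalIdeal ↥(OF F) • (⊤ : Submodule ↥(OF F) Λ))
    ((LinearMap.range (π • (LinearMap.id : StableLattice Λ hst →ₗ[ActionAlgebra Γ]
      StableLattice Λ hst))).restrictScalars ↥(OF F))
    (LinearEquiv.refl ↥(OF F) ↥Λ : Λ ≃ₗ[↥(OF F)] StableLattice Λ hst) (by
      rw [hπ, Submodule.ideal_span_singleton_smul]
      ext x
      constructor
      · rintro ⟨_, ⟨y, -, rfl⟩, rfl⟩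
        exact ⟨y, rfl⟩
      · rintro ⟨y, rfl⟩
        exact ⟨_, ⟨y, trivial, rfl⟩, rfl⟩)).trans
  (Submodule.Quotient.restrictScalarsEquiv ↥(OF F) _)

lemma redEquiv_redMap (hπ : maximalIdeal ↥(OF F) = Ideal.span {π}) (g : Γ) (x : Red Λ) :
    redEquiv hst hπ (redMap Λ _ (hst g.1 g.2) x) = actionGenerator Γ g • redEquiv hst hπ x := by
  obtain ⟨x, rfl⟩ := Submodule.Quotient.mk_surjective
    (maximalIdeal ↥(OF F) • (⊤ : Submodule ↥(OF F) Λ)) x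
  rfl

lemma sSonRed_iff (hπ : maximalIdeal ↥(OF F) = Ideal.span {π}) :
    SSonRed Γ Λ hst ↔
      IsSemisimpleModule (ActionAlgebra Γ)
        (Reduction (ActionAlgebra Γ) π (StableLattice Λ hst)) := by
  rw [isSemisimpleModule_iff_operators (adjoin_actionGenerator Γ)
    (fun g : Γ => redMap Λ _ (hst g.1 g.2)) (redEquiv hst hπ) (redEquiv_redMap hπ)]
  simp only [SSonRed, Subtype.forall]

lemma natCard_redEnd (hπ : maximalIdeal ↥(OF F) = Ideal.span {π}) :
    Nat.card (RedEnd Γ Λ hst) =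
      Nat.card (Reduction (ActionAlgebra Γ) π (StableLattice Λ hst) →ₗ[ActionAlgebra Γ]
        Reduction (ActionAlgebra Γ) π (StableLattice Λ hst)) := by
  rw [← natCard_commutant_eq (adjoin_actionGenerator Γ)
    (fun g : Γ => redMap Λ _ (hst g.1 g.2)) (redEquiv hst hπ) (redEquiv_redMap hπ)]
  exact Nat.card_congr (Equiv.subtypeEquivRight fun f => by simp only [Subtype.forall])

lemma finite_stableLattice (hFG : Λ.FG) : Module.Finite ↥(OF F) (StableLattice Λ hst) :=
  Module.Finite.of_fg (N := Λ) hFG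

lemma isTorsionFree_stableLattice : Module.IsTorsionFree ↥(OF F) (StableLattice Λ hst) :=
  Function.Injective.moduleIsTorsionFree StableLattice.incl
    StableLattice.incl_injective (fun _ _ => rfl)

lemma commDim_eq [IsDiscreteValuationRing ↥(OF F)] (hπ : Irreducible π) (hFG : Λ.FG)
    {W : Submodule F (Fin m → F)} (hspan : Submodule.span F (Λ : Set (Fin m → F)) = W)
    (hW : ∀ g ∈ Γ, ∀ x ∈ W, ((g : Matrix (Fin m) (Fin m) F)).mulVecLin x ∈ W) :
    commDim Γ W = Module.finrank ↥(OF F)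
      (StableLattice Λ hst →ₗ[ActionAlgebra Γ] StableLattice Λ hst) := by
  have := finite_stableLattice (hst := hst) hFG
  have hΛW : ∀ x : StableLattice Λ hst, StableLattice.incl x ∈ W := fun x =>
    hspan ▸ Submodule.subset_span x.incl_mem
  let j : StableLattice Λ hst →ₗ[↥(OF F)] W :=
    StableLattice.incl.codRestrict (W.restrictScalars ↥(OF F)) hΛW
  have hj : Function.Injective j := fun x y hxy =>
    StableLattice.incl_injective (congrArg W.subtype hxy)
  have hspan_j : Submodule.span F (LinearMap.range j : Set W) = ⊤ := by
    refine Submodule.map_injective_of_injective W.injective_subtype ?_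
    rw [Submodule.map_span, Submodule.map_top, Submodule.range_subtype]
    refine Eq.trans (congrArg (Submodule.span F) ?_) hspan
    ext x
    constructor
    · rintro ⟨_, ⟨y, rfl⟩, rfl⟩
      exact y.incl_mem
    · intro hx
      obtain ⟨y, rfl⟩ := StableLattice.exists_incl_eq hst hx
      exact ⟨_, ⟨y, rfl⟩, rfl⟩
  refine finrank_commutant_eq (K := F) hπ j hj hspan_j
    (Subalgebra.toSubmodule (Subalgebra.centralizer F (restrictedAction Γ W))) fun c f hcf => ?_
  have hj_smul : ∀ (g : Γ) x, j (actionGenerator Γ g • x) =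
      LinearMap.restrict _ (hW g.1 g.2) (j x) := fun _ _ => rfl
  rw [Subalgebra.mem_toSubmodule, Subalgebra.mem_centralizer_iff]
  constructor
  · intro hc
    refine map_smul_of_generators (adjoin_actionGenerator Γ) f fun g x => hj ?_
    have := LinearMap.congr_fun (hc _ ⟨g.1, g.2, hW g.1 g.2, rfl⟩) (j x)
    rw [Module.End.mul_apply, Module.End.mul_apply] at this
    rw [hj_smul, ← hcf, ← hcf, hj_smul, this]
  · rintro hf _ ⟨g, hg, hgW, rfl⟩
    refine LinearMap.ext_on hspan_j ?_
    rintro _ ⟨x, rfl⟩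
    have := hf (actionGenerator Γ ⟨g, hg⟩) x
    rw [Module.End.mul_apply, Module.End.mul_apply, hcf]
    exact ((hj_smul ⟨g, hg⟩ (f x)).symm.trans (congrArg j this.symm)).trans
      ((hcf _).symm.trans (congrArg c (hj_smul ⟨g, hg⟩ x)))

lemma hasOptimalReduction_iff [IsDiscreteValuationRing ↥(OF F)] (hπ : Irreducible π) (hFG : Λ.FG)
    {W : Submodule F (Fin m → F)} (hspan : Submodule.span F (Λ : Set (Fin m → F)) = W)
    (hW : ∀ g ∈ Γ, ∀ x ∈ W, ((g : Matrix (Fin m) (Fin m) F)).mulVecLin x ∈ W) :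
    HasOptimalReduction (ActionAlgebra Γ) π (StableLattice Λ hst) ↔
      SSonRed Γ Λ hst ∧
        Nat.card (RedEnd Γ Λ hst) = Nat.card (ResidueField ↥(OF F)) ^ commDim Γ W := by
  have hcard : Nat.card (ResidueField ↥(OF F)) = Nat.card (↥(OF F) ⧸ Ideal.span {π}) := by
    rw [← hπ.maximalIdeal_eq]
    rfl
  rw [HasOptimalReduction, sSonRed_iff hπ.maximalIdeal_eq, natCard_redEnd hπ.maximalIdeal_eq,
    hcard, commDim_eq (hst := hst) hπ hFG hspan hW]

/-- The sum of two stable lattices, scaled into a third one. -/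
def StableLattice.scaledSum {Λ₁ Λ₂ : Submodule ↥(OF F) (Fin m → F)}
    {hst₁ : ∀ g ∈ Γ, MStab Λ₁ (g : Matrix (Fin m) (Fin m) F)}
    {hst₂ : ∀ g ∈ Γ, MStab Λ₂ (g : Matrix (Fin m) (Fin m) F)} (a : ↥(OF F))
    (h₁ : ∀ x ∈ Λ₁, a • x ∈ Λ) (h₂ : ∀ x ∈ Λ₂, a • x ∈ Λ) :
    (StableLattice Λ₁ hst₁ × StableLattice Λ₂ hst₂) →ₗ[ActionAlgebra Γ] StableLattice Λ hst :=
  let f : (StableLattice Λ₁ hst₁ × StableLattice Λ₂ hst₂) →ₗ[↥(OF F)] StableLattice Λ hst :=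
    (a • incl.coprod incl).codRestrict Λ fun x => by
      rw [LinearMap.smul_apply, LinearMap.coprod_apply, smul_add]
      exact Λ.add_mem (h₁ _ x.1.incl_mem) (h₂ _ x.2.incl_mem)
  { f with
    map_smul' := map_smul_of_generators (adjoin_actionGenerator Γ) f fun g x => by
      apply incl_injective
      change a • (incl (actionGenerator Γ g • x.1) + incl (actionGenerator Γ g • x.2)) =
        incl (actionGenerator Γ g • f x)
      rw [incl_actionGenerator_smul, incl_actionGenerator_smul, incl_actionGenerator_smul,
        ← map_add, ← LinearMap.map_smul_of_tower]
      rfl }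

lemma StableLattice.incl_scaledSum {Λ₁ Λ₂ : Submodule ↥(OF F) (Fin m → F)}
    {hst₁ : ∀ g ∈ Γ, MStab Λ₁ (g : Matrix (Fin m) (Fin m) F)}
    {hst₂ : ∀ g ∈ Γ, MStab Λ₂ (g : Matrix (Fin m) (Fin m) F)} {a : ↥(OF F)}
    (h₁ : ∀ x ∈ Λ₁, a • x ∈ Λ) (h₂ : ∀ x ∈ Λ₂, a • x ∈ Λ)
    (x : StableLattice Λ₁ hst₁ × StableLattice Λ₂ hst₂) :
    incl (scaledSum (hst := hst) a h₁ h₂ x) = a • (incl x.1 + incl x.2) := rfl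

/-- Optimal reduction passes from a lattice in the full space to lattices in a stable subspace
with a stable complement. -/
lemma hasOptimalReduction_of_isCompl [IsDiscreteValuationRing ↥(OF F)]
    [Finite (ResidueField ↥(OF F))] (hπ : Irreducible π) (hFG : Λ.FG)
    (hfull : Submodule.span F (Λ : Set (Fin m → F)) = ⊤)
    (h : HasOptimalReduction (ActionAlgebra Γ) π (StableLattice Λ hst))
    {W W' : Submodule F (Fin m → F)} (hWW' : IsCompl W W')
    (hW' : ∀ g ∈ Γ, ∀ x ∈ W', ((g : Matrix (Fin m) (Fin m) F)).mulVecLin x ∈ W')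
    {ΛW : Submodule ↥(OF F) (Fin m → F)} (hFGW : ΛW.FG)
    (hspan : Submodule.span F (ΛW : Set (Fin m → F)) = W)
    (hstW : ∀ g ∈ Γ, MStab ΛW (g : Matrix (Fin m) (Fin m) F)) :
    HasOptimalReduction (ActionAlgebra Γ) π (StableLattice ΛW hstW) := by
  have : Finite (↥(OF F) ⧸ Ideal.span {π}) := by
    rw [← hπ.maximalIdeal_eq]
    exact ‹Finite (ResidueField ↥(OF F))›
  have hpow : ∀ l : ℕ, algebraMap ↥(OF F) F (π ^ l) ≠ 0 := fun l => by simp [hπ.ne_zero]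
  let Λ' : Submodule ↥(OF F) (Fin m → F) := Λ ⊓ W'.restrictScalars ↥(OF F)
  have hst' : ∀ g ∈ Γ, MStab Λ' (g : Matrix (Fin m) (Fin m) F) := fun g hg x hx =>
    ⟨hst g hg x hx.1, hW' g hg x hx.2⟩
  have : IsNoetherian ↥(OF F) Λ := isNoetherian_of_fg_of_noetherian Λ hFG
  have hFG' : Λ'.FG := Submodule.FG.of_le hFG inf_le_left
  have := finite_stableLattice (hst := hst) hFG
  have := finite_stableLattice (hst := hstW) hFGW
  have := finite_stableLattice (hst := hst') hFG'
  have := isTorsionFree_stableLattice (hst := hst)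
  have := isTorsionFree_stableLattice (hst := hstW)
  have := isTorsionFree_stableLattice (hst := hst')
  obtain ⟨n, hn⟩ := exists_pow_smul_mem_of_fg (K := F) hπ Λ hFGW
    fun _ _ => hfull ▸ Submodule.mem_top
  let i := StableLattice.scaledSum (hst := hst) (hst₁ := hstW) (hst₂ := hst') (π ^ n) hn
    fun x hx => Λ.smul_mem _ hx.1
  have hi : Function.Injective i := by
    refine (injective_iff_map_eq_zero i).2 fun x hx => ?_
    have hx₁ : StableLattice.incl x.1 ∈ W := hspan ▸ Submodule.subset_span x.1.incl_mem
    have hx₂ : StableLattice.incl x.2 ∈ W' := x.2.incl_mem.2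
    have hsum : StableLattice.incl x.1 + StableLattice.incl x.2 = 0 := by
      have := congrArg StableLattice.incl hx
      rw [StableLattice.incl_scaledSum, map_zero] at this
      rwa [← algebraMap_smul F (π ^ n), smul_eq_zero_iff_right (hpow n)] at this
    have hx₁' : StableLattice.incl x.1 = 0 := Submodule.disjoint_def.1 hWW'.disjoint _ hx₁
      (eq_neg_of_add_eq_zero_left hsum ▸ W'.neg_mem hx₂)
    refine Prod.ext (StableLattice.incl_injective (hx₁'.trans (map_zero _).symm))
      (StableLattice.incl_injective (Eq.trans ?_ (map_zero _).symm))
    rwa [hx₁', zero_add] at hsum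
  obtain ⟨k, hk⟩ := exists_pow_smul_mem_of_fg (K := F) hπ (ΛW ⊔ Λ') hFG fun x _ => by
    obtain ⟨y, hy, z, hz, rfl⟩ :=
      Submodule.mem_sup.1 (hWW'.sup_eq_top ▸ Submodule.mem_top (x := x))
    refine Submodule.add_mem _ (Submodule.span_mono (fun _ => Submodule.mem_sup_left)
      (hspan.symm ▸ hy)) ?_
    obtain ⟨l, hl⟩ := exists_pow_smul_mem (K := F) hπ Λ (x := z) (hfull ▸ Submodule.mem_top)
    rw [← Submodule.smul_mem_iff _ (hpow l), algebraMap_smul]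
    exact Submodule.subset_span (Submodule.mem_sup_right
      ⟨hl, (W'.restrictScalars ↥(OF F)).smul_mem _ hz⟩)
  refine (h.of_injective hπ.ne_zero i hi (n + k) fun x => ?_).of_prod hπ.ne_zero
  obtain ⟨y, hy, z, hz, hyz⟩ := Submodule.mem_sup.1 (hk _ x.incl_mem)
  obtain ⟨y, rfl⟩ := StableLattice.exists_incl_eq hstW hy
  obtain ⟨z, rfl⟩ := StableLattice.exists_incl_eq hst' hz
  refine ⟨(y, z), StableLattice.incl_injective ?_⟩
  rw [StableLattice.incl_scaledSum, hyz, map_smul, pow_add, mul_smul]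

end Matrices

/-- (i) ⇒ (ii) of Proposition on reductions of lattices: Let `F` be a
complete discretely valued field of characteristic zero with valuation ring `O_F` and
finite residue field `𝔽_q`, and let `Γ` be a compact subgroup of `GL(V)`, `V = F^m`,
acting semisimply on `V`.  Suppose for some `Γ`-stable lattice `Λ ⊂ V` the reduction
`Λ ⊗ 𝔽_q` is a semisimple `Γ`-representation with
`dim_F End_Γ(V) = dim_{𝔽_q} End_Γ(Λ ⊗ 𝔽_q)` (the dimension equality over the finite
residue field is expressed via cardinalities: `|End_Γ(Λ ⊗ 𝔽_q)| = q ^ dim_F End_Γ(V)`).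
Then for every `Γ`-subrepresentation `W ⊆ V` and every `Γ`-stable lattice `Λ_W` of `W`,
the reduction `Λ_W ⊗ 𝔽_q` is semisimple and
`dim_F End_Γ(W) = dim_{𝔽_q} End_Γ(Λ_W ⊗ 𝔽_q)`. -/
theorem stmt_12 (F : Type) [Field F] [Valued F Zm0] [CompleteSpace F] [CharZero F]
    (hdisc : Function.Surjective (Valued.v : F → Zm0))
    [Finite (ResidueField ↥(OF F))]
    (m : ℕ) (Γ : Subgroup (GL (Fin m) F))
    (hcpt : IsCompact ((Γ : Set (GL (Fin m) F))))
    (hssV : SSonSub Γ (⊤ : Submodule F (Fin m → F)))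
    (Λ : Submodule ↥(OF F) (Fin m → F)) (hFG : Λ.FG)
    (hfull : Submodule.span F (Λ : Set (Fin m → F)) = ⊤)
    (hst : ∀ g ∈ Γ, MStab Λ (g : Matrix (Fin m) (Fin m) F))
    (hssRed : SSonRed Γ Λ hst)
    (hdim : Nat.card (RedEnd Γ Λ hst) =
      Nat.card (ResidueField ↥(OF F)) ^ commDim Γ (⊤ : Submodule F (Fin m → F))) :
    ∀ (W : Submodule F (Fin m → F)),
      (∀ g ∈ Γ, ∀ x ∈ W, ((g : Matrix (Fin m) (Fin m) F)).mulVecLin x ∈ W) →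
      ∀ (ΛW : Submodule ↥(OF F) (Fin m → F)), (ΛW : Set (Fin m → F)) ⊆ (W : Set (Fin m → F)) →
        ΛW.FG → Submodule.span F (ΛW : Set (Fin m → F)) = W →
        ∀ hstW : ∀ g ∈ Γ, MStab ΛW (g : Matrix (Fin m) (Fin m) F),
          SSonRed Γ ΛW hstW ∧
          Nat.card (RedEnd Γ ΛW hstW) = Nat.card (ResidueField ↥(OF F)) ^ commDim Γ W := by
  intro W hW ΛW _ hFGW hspan hstW
  have := isDiscreteValuationRing_OF hdisc
  obtain ⟨π, hπ⟩ := IsDiscreteValuationRing.exists_irreducible ↥(OF F)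
  obtain ⟨W', -, hW', hinf, hsup⟩ := hssV W le_top hW
  exact (hasOptimalReduction_iff hπ hFGW hspan hW).1 <|
    hasOptimalReduction_of_isCompl hπ hFG hfull
      ((hasOptimalReduction_iff hπ hFG hfull fun _ _ _ _ => Submodule.mem_top).2 ⟨hssRed, hdim⟩)
      (IsCompl.of_eq hinf hsup) hW' hFGW hspan hstW

end
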